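/- (Theorem 3.2: adaptedness of the solution.) Let d ≥ 1, ν > 0, T > 0, β ∈ (0,1). Let (Ω, F, P) be a probability space with a filtration (G_t)_{t ∈ [0,T]}, and let η : Ω × [0,T] × ℝ^d → ℝ^d be such that for every ω ∈ Ω the path η(ω, ·, ·) belongs to C^{0,2}_b([0,T] × ℝ^d; ℝ^d) and satisfies η(ω, 0, ·) = 0, and for every (t,x) ∈ [0,T] × ℝ^d the map ω ↦ η(ω,t,x) is G_t-measurable. Let φ ∈ C^β_b(ℝ^d; ℝ^d) be deterministic. Suppose y : Ω × [0,T] × ℝ^d → ℝ^d is such that for every ω, the function y(ω, ·, ·) is the (unique) solution of the equation y(t,x) = φ(x) + ∫_0^t [ν Δy(s,x) − (y(s,x), ∂_x) y(s,x)] ds + η(ω,t,x) in the class of functions z with z − η(ω,·,·) continuous and bounded on [0,T] × ℝ^d and twice continuously differentiable in x on (0,T] × ℝ^d with bounded first and second spatial derivatives. Then for every (t,x) ∈ [0,T] × ℝ^d, the map ω ↦ y(ω,t,x) is G_t-measurable. -/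

import Mathlib

open MeasureTheory Set Filter
open scoped Topology

noncomputable section

/-- `ℝ^d` with the Euclidean norm. -/
abbrev Ed (d : ℕ) := EuclideanSpace ℝ (Fin d)

/-- Componentwise spatial Laplacian of a map `u : ℝ^d → ℝ^d`. -/
noncomputable def lapl {d : ℕ} (u : Ed d → Ed d) (x : Ed d) : Ed d :=
  ∑ j : Fin d, fderiv ℝ (fun z => fderiv ℝ u z (EuclideanSpace.single j (1:ℝ))) x
    (EuclideanSpace.single j (1:ℝ))

/-- `η ∈ C^{0,2}_b([0,T] × ℝ^d; ℝ^d)`. -/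
structure IsC02b {d : ℕ} (T : ℝ) (η : ℝ → Ed d → Ed d) : Prop where
  cont : ContinuousOn (fun p : ℝ × Ed d => η p.1 p.2) (Icc (0:ℝ) T ×ˢ (univ : Set (Ed d)))
  contDiffX : ∀ t ∈ Icc (0:ℝ) T, ContDiff ℝ 2 (η t)
  bdd : ∃ M : ℝ, ∀ t ∈ Icc (0:ℝ) T, ∀ x, ‖η t x‖ ≤ M ∧ ‖fderiv ℝ (η t) x‖ ≤ M ∧
    ‖fderiv ℝ (fderiv ℝ (η t)) x‖ ≤ M

/-- `φ ∈ C^β_b(ℝ^d; ℝ^d)`: bounded and `β`-Hölder continuous. -/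
structure IsCBetaB {d : ℕ} (β : ℝ) (φ : Ed d → Ed d) : Prop where
  bdd : ∃ M : ℝ, ∀ x, ‖φ x‖ ≤ M
  holder : ∃ L : ℝ, 0 ≤ L ∧ ∀ x x', ‖φ x - φ x'‖ ≤ L * ‖x - x'‖ ^ β

/-- Regularity class of Theorem 3.1: `w = z − η` is continuous and bounded on
`[0,T] × ℝ^d`, twice continuously differentiable in `x` on `(0,T] × ℝ^d` with bounded
first and second spatial derivatives there. -/
structure RegClass {d : ℕ} (T : ℝ) (w : ℝ → Ed d → Ed d) : Prop where
  cont : ContinuousOn (fun p : ℝ × Ed d => w p.1 p.2) (Icc (0:ℝ) T ×ˢ (univ : Set (Ed d)))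
  bdd : ∃ M : ℝ, ∀ t ∈ Icc (0:ℝ) T, ∀ x, ‖w t x‖ ≤ M
  contDiffX : ∀ t ∈ Ioc (0:ℝ) T, ContDiff ℝ 2 (w t)
  bddDeriv : ∃ M : ℝ, ∀ t ∈ Ioc (0:ℝ) T, ∀ x,
    ‖fderiv ℝ (w t) x‖ ≤ M ∧ ‖fderiv ℝ (fderiv ℝ (w t)) x‖ ≤ M

/-- A function `z` solves the stochastic Burgers equation with noise path `e` and initial
condition `φ`, within the natural regularity class. -/
def SolvesBurgers {d : ℕ} (ν T : ℝ) (φ : Ed d → Ed d) (e z : ℝ → Ed d → Ed d) : Prop :=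
  RegClass T (fun t x => z t x - e t x) ∧
  ∀ t ∈ Icc (0:ℝ) T, ∀ x,
    z t x = φ x +
      (∫ s in (0:ℝ)..t, (ν • lapl (z s) x - fderiv ℝ (z s) x (z s x))) + e t x


/-! ### discrete operator -/

def gop {d : ℕ} (ν h : ℝ) (u : Ed d → Ed d) (x : Ed d) : Ed d :=
  ∑ j : Fin d, ((ν / h ^ 2) • (u (x + h • EuclideanSpace.single j (1:ℝ))
      + u (x - h • EuclideanSpace.single j (1:ℝ)) - (2:ℝ) • u x)
    - (u x j / h) • (u (x + h • EuclideanSpace.single j (1:ℝ)) - u x))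

structure GoodB {d : ℕ} (M : ℝ) (u : Ed d → Ed d) : Prop where
  bd : ∀ x, ‖u x‖ ≤ M
  lip : ∀ x v, ‖u (x + v) - u x‖ ≤ M * ‖v‖
  snd : ∀ x v, ‖u (x + v) + u (x - v) - (2:ℝ) • u x‖ ≤ M * ‖v‖ ^ 2

def wt {d : ℕ} (x : Ed d) : ℝ := Real.exp (-‖x‖)

lemma wt_pos {d : ℕ} (x : Ed d) : 0 < wt x := Real.exp_pos _

lemma wt_cont {d : ℕ} : Continuous (wt : Ed d → ℝ) := by unfold wt; fun_prop

lemma wt_int {d : ℕ} : Integrable (wt : Ed d → ℝ) := by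
  have h := integrable_one_add_norm (E := Ed d) (μ := volume) (r := (d + 1 : ℕ))
    (by simp)
  refine (h.const_mul (((d+1).factorial : ℝ) * Real.exp 1)).mono' wt_cont.aestronglyMeasurable ?_
  refine Eventually.of_forall fun x => ?_
  have h0 : (0:ℝ) ≤ 1 + ‖x‖ := by positivity
  have h1 := Real.pow_div_factorial_le_exp (x := 1 + ‖x‖) h0 (d+1)
  rw [Real.norm_of_nonneg (wt_pos x).le, Real.rpow_neg h0, Real.rpow_natCast]
  unfold wt
  rw [Real.exp_neg]
  have h2 : (0:ℝ) < (1 + ‖x‖) ^ (d+1) := by positivity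
  have h3 : (0:ℝ) < ((d+1).factorial : ℝ) := by positivity
  rw [div_le_iff₀ h3, Real.exp_add] at h1
  rw [← div_eq_mul_inv, le_div_iff₀ h2, inv_mul_le_iff₀ (Real.exp_pos _)]
  linarith

lemma wt_shift {d : ℕ} (x v : Ed d) (hv : ‖v‖ ≤ 1) :
    |wt (x + v) - wt x| ≤ 2 * ‖v‖ * wt x := by
  have key : ∀ s : ℝ, |s| ≤ ‖v‖ → |Real.exp s - 1| ≤ 2 * ‖v‖ := by
    intro s hs
    have := Real.abs_exp_sub_one_le (x := s) (hs.trans hv)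
    linarith
  have e : wt (x + v) - wt x = wt x * (Real.exp (‖x‖ - ‖x + v‖) - 1) := by
    unfold wt
    rw [mul_sub, ← Real.exp_add]; ring_nf
  rw [e, abs_mul, abs_of_pos (wt_pos x), mul_comm]
  refine mul_le_mul_of_nonneg_right (key _ ?_) (wt_pos x).le
  have := abs_norm_sub_norm_le x (x + v)
  simpa using this

lemma wt_mul_int {d : ℕ} {f : Ed d → ℝ} (hf : Continuous f) {K : ℝ} (hK : ∀ x, |f x| ≤ K) :
    Integrable (fun x => wt x * f x) := by
  refine (wt_int.mul_const K).mono' (wt_cont.mul hf).aestronglyMeasurable ?_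
  refine Eventually.of_forall fun x => ?_
  rw [norm_mul, Real.norm_of_nonneg (wt_pos x).le]
  exact mul_le_mul_of_nonneg_left (hK x) (wt_pos x).le

lemma gop_cont {d : ℕ} {ν h : ℝ} {u : Ed d → Ed d} (hu : Continuous u) :
    Continuous (gop ν h u) := by
  unfold gop
  fun_prop

lemma coord_le {d : ℕ} (v : Ed d) (j : Fin d) : |v j| ≤ ‖v‖ := by
  simpa using PiLp.norm_apply_le v j

lemma single_norm {d : ℕ} {h : ℝ} (hh : 0 < h) (j : Fin d) :
    ‖h • (EuclideanSpace.single j (1:ℝ) : Ed d)‖ = h := by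
  rw [norm_smul]; simp [abs_of_pos hh]

lemma gop_bd {d : ℕ} {ν h M : ℝ} (hν : 0 < ν) (hh : 0 < h) (hM : 0 ≤ M)
    {u : Ed d → Ed d} (hu : GoodB M u) (x : Ed d) :
    ‖gop ν h u x‖ ≤ d * (ν * M + M * M) := by
  unfold gop
  have : ∀ j ∈ (Finset.univ : Finset (Fin d)), ‖((ν / h ^ 2) • (u (x + h • EuclideanSpace.single j (1:ℝ))
      + u (x - h • EuclideanSpace.single j (1:ℝ)) - (2:ℝ) • u x)
    - (u x j / h) • (u (x + h • EuclideanSpace.single j (1:ℝ)) - u x))‖ ≤ ν * M + M * M := by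
    intro j _
    refine (norm_sub_le _ _).trans (add_le_add ?_ ?_)
    · rw [norm_smul, Real.norm_of_nonneg (by positivity)]
      have := hu.snd x (h • EuclideanSpace.single j (1:ℝ))
      rw [single_norm hh] at this
      calc _ ≤ (ν / h^2) * (M * h^2) := by gcongr
        _ = ν * M := by field_simp
    · rw [norm_smul, norm_div, Real.norm_of_nonneg hh.le]
      have := hu.lip x (h • EuclideanSpace.single j (1:ℝ))
      rw [single_norm hh] at this
      have h2 : ‖u x j‖ ≤ M := (coord_le _ _).trans (hu.bd x)
      calc _ ≤ (M / h) * (M * h) := by gcongr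
        _ = M * M := by field_simp
  refine (norm_sum_le_of_le _ this).trans ?_
  simp [mul_add]

/-- pointwise inequality -/
lemma ptw {E : Type*} [NormedAddCommGroup E] [InnerProductSpace ℝ E]
    {ν M h w wp c b : ℝ} (hν : 0 < ν) (hM : 0 ≤ M) (hh : 0 < h) (hw : 0 < w)
    (hwp : |wp - w| ≤ 2 * h * w) (δ δp q : E) (hc : |c| ≤ M) (hb : |b| ≤ ‖δ‖)
    (ha : ‖δp - δ‖ ≤ 2 * M * h) (hq : ‖q‖ ≤ M * h) :
    w * inner ℝ δ ((ν / h ^ 2) • (δp - δ)) + wp * inner ℝ δp ((ν / h ^ 2) • (δ - δp))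
      - w * inner ℝ δ ((c / h) • (δp - δ)) - w * inner ℝ δ ((b / h) • q)
      ≤ w * (((2 * ν + M) ^ 2 / (4 * ν) + M) * ‖δ‖ ^ 2) + w * (8 * ν * M ^ 2 * h) := by
  obtain ⟨a, rfl⟩ : ∃ a, δp = δ + h • a := ⟨h⁻¹ • (δp - δ), by
    rw [smul_smul, mul_inv_cancel₀ hh.ne', one_smul]; abel⟩
  obtain ⟨p, rfl⟩ : ∃ p, q = h • p := ⟨h⁻¹ • q, by
    rw [smul_smul, mul_inv_cancel₀ hh.ne', one_smul]⟩
  obtain ⟨k, rfl⟩ : ∃ k, wp = w + h * w * k := ⟨(wp - w) / (h * w), by field_simp; ring⟩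
  have hk : |k| ≤ 2 := by
    rw [show w + h * w * k - w = (h * w) * k by ring, abs_mul, abs_of_pos (by positivity)] at hwp
    have : (h * w) * |k| ≤ (h * w) * 2 := by linarith
    exact le_of_mul_le_mul_left this (by positivity)
  have e1 : δ + h • a - δ = h • a := by abel
  have e2 : δ - (δ + h • a) = - (h • a) := by abel
  rw [e1, norm_smul, Real.norm_of_nonneg hh.le] at ha
  rw [norm_smul, Real.norm_of_nonneg hh.le] at hq
  have ha' : ‖a‖ ≤ 2 * M := le_of_mul_le_mul_left (by linarith) hh
  have hq' : ‖p‖ ≤ M := le_of_mul_le_mul_left (by linarith) hh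
  rw [e1, e2]
  simp only [inner_add_left, inner_smul_left, inner_smul_right, inner_neg_right, real_inner_self_eq_norm_sq,
    conj_trivial]
  have i1 := abs_real_inner_le_norm δ a
  have i2 := abs_real_inner_le_norm δ p
  set I := inner ℝ δ a
  set J := inner ℝ δ p
  have t1 : -(k * I) ≤ 2 * (‖δ‖ * ‖a‖) := by
    refine (neg_le_abs _).trans ?_
    rw [abs_mul]; gcongr
  have t2 : -(k * ‖a‖^2) ≤ 2 * (2 * M) ^ 2 := by
    refine (neg_le_abs _).trans ?_
    rw [abs_mul, abs_of_nonneg (sq_nonneg ‖a‖)]; gcongr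
  have t3 : -(c * I) ≤ M * (‖δ‖ * ‖a‖) := by
    refine (neg_le_abs _).trans ?_
    rw [abs_mul]; gcongr
  have t4 : -(b * J) ≤ ‖δ‖ * (‖δ‖ * M) := by
    refine (neg_le_abs _).trans ?_
    rw [abs_mul]; gcongr
    exact i2.trans (by gcongr)
  have t5 : (2 * ν + M) * (‖δ‖ * ‖a‖) ≤ ν * ‖a‖ ^ 2 + (2 * ν + M) ^ 2 / (4 * ν) * ‖δ‖ ^ 2 := by
    have : 0 ≤ (2 * ν * ‖a‖ - (2 * ν + M) * ‖δ‖) ^ 2 / (4 * ν) := by positivity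
    have e : (2 * ν * ‖a‖ - (2 * ν + M) * ‖δ‖) ^ 2 / (4 * ν) =
      ν * ‖a‖ ^ 2 + (2 * ν + M) ^ 2 / (4 * ν) * ‖δ‖ ^ 2 - (2 * ν + M) * (‖δ‖ * ‖a‖) := by
      field_simp; ring
    linarith
  have e : w * (ν / h ^ 2 * (h * I)) +
        (w + h * w * k) * (-(ν / h ^ 2 * (h * I)) + -(h * (ν / h ^ 2 * (h * ‖a‖^2)))) - w * (c / h * (h * I)) -
      w * (b / h * (h * J)) = w * (ν * (-(k * I)) - ν * ‖a‖^2 + ν * h * (-(k * ‖a‖^2)) + (-(c * I)) + (-(b*J))) := by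
    field_simp
    ring
  have : ν * (-(k * I)) - ν * ‖a‖^2 + ν * h * (-(k * ‖a‖^2)) + (-(c * I)) + (-(b*J)) ≤
    ((2 * ν + M) ^ 2 / (4 * ν) + M) * ‖δ‖ ^ 2 + (8 * ν * M ^ 2 * h) := by
    have s1 := mul_le_mul_of_nonneg_left t1 hν.le
    have s2 := mul_le_mul_of_nonneg_left t2 (mul_pos hν hh).le
    nlinarith
  have := mul_le_mul_of_nonneg_left this hw.le
  rw [← mul_add]
  refine le_trans (le_of_eq ?_) this
  rw [← e]
  ring_nf

lemma int4 {α : Type*} [MeasurableSpace α] {μ : Measure α} {A B C D : α → ℝ} (iA : Integrable A μ)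
    (iB : Integrable B μ) (iC : Integrable C μ) (iD : Integrable D μ) :
    ∫ x, (A x + B x - C x - D x) ∂μ = ∫ x, A x ∂μ + ∫ x, B x ∂μ - ∫ x, C x ∂μ - ∫ x, D x ∂μ := by
  have h1 : Integrable (fun x => A x + B x) μ := iA.add iB
  have h2 : Integrable (fun x => A x + B x - C x) μ := h1.sub iC
  rw [integral_sub h2 iD, integral_sub h1 iC, integral_add iA iB]

lemma energy_fixed {d : ℕ} {ν M h : ℝ} (hν : 0 < ν) (hM : 0 ≤ M) (hh : 0 < h) (hh1 : h ≤ 1)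
    {u1 u2 : Ed d → Ed d} (c1 : Continuous u1) (c2 : Continuous u2)
    (g1 : GoodB M u1) (g2 : GoodB M u2) :
    ∫ x, wt x * inner ℝ (u1 x - u2 x) (gop ν h u1 x - gop ν h u2 x) ≤
      d * ((2 * ν + M) ^ 2 / (4 * ν) + M) * (∫ x, wt x * ‖u1 x - u2 x‖ ^ 2)
      + (d * (8 * ν * M ^ 2) * ∫ x : Ed d, wt x) * h := by
  set δ : Ed d → Ed d := fun x => u1 x - u2 x with hδ
  have cδ : Continuous δ := c1.sub c2
  have bδ : ∀ x, ‖δ x‖ ≤ 2 * M := fun x => by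
    have := norm_sub_le (u1 x) (u2 x)
    have := g1.bd x
    have := g2.bd x
    simp only [hδ]; linarith
  set s : Fin d → Ed d := fun j => h • EuclideanSpace.single j (1:ℝ) with hs
  have ns : ∀ j, ‖s j‖ = h := fun j => single_norm hh j
  set A : Fin d → Ed d → ℝ := fun j x => wt x * inner ℝ (δ x) ((ν / h ^ 2) • (δ (x + s j) - δ x))
  set B : Fin d → Ed d → ℝ := fun j x => wt x * inner ℝ (δ x) ((ν / h ^ 2) • (δ (x - s j) - δ x))
  set C : Fin d → Ed d → ℝ := fun j x => wt x * inner ℝ (δ x) ((u2 x j / h) • (δ (x + s j) - δ x))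
  set D : Fin d → Ed d → ℝ := fun j x => wt x * inner ℝ (δ x) ((δ x j / h) • (u1 (x + s j) - u1 x))
  have bin : ∀ (f : Ed d → Ed d), (∃ K, ∀ x, ‖f x‖ ≤ K) → ∃ K, ∀ x, |inner ℝ (δ x) (f x)| ≤ K := by
    rintro f ⟨K, hK⟩
    refine ⟨2 * M * K, fun x => (abs_real_inner_le_norm _ _).trans ?_⟩
    have := norm_nonneg (f x)
    gcongr
    exacts [bδ x, hK x]
  have bdif : ∀ v x, ‖δ (x + v) - δ x‖ ≤ 2 * M + 2 * M := fun v x =>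
    (norm_sub_le _ _).trans (add_le_add (bδ _) (bδ _))
  have bdif' : ∀ v x, ‖δ (x - v) - δ x‖ ≤ 2 * M + 2 * M := fun v x =>
    (norm_sub_le _ _).trans (add_le_add (bδ _) (bδ _))
  have iA : ∀ j, Integrable (A j) := by
    intro j
    obtain ⟨K, hK⟩ := bin (fun x => (ν / h ^ 2) • (δ (x + s j) - δ x))
      ⟨|ν / h^2| * (2 * M + 2 * M), fun x => by
        rw [norm_smul]; gcongr; exacts [le_rfl, bdif _ _]⟩
    exact wt_mul_int (by fun_prop) hK
  have iB : ∀ j, Integrable (B j) := by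
    intro j
    obtain ⟨K, hK⟩ := bin (fun x => (ν / h ^ 2) • (δ (x - s j) - δ x))
      ⟨|ν / h^2| * (2 * M + 2 * M), fun x => by
        rw [norm_smul]; gcongr; exacts [le_rfl, bdif' _ _]⟩
    exact wt_mul_int (by fun_prop) hK
  have iC : ∀ j, Integrable (C j) := by
    intro j
    obtain ⟨K, hK⟩ := bin (fun x => (u2 x j / h) • (δ (x + s j) - δ x))
      ⟨(M / h) * (2 * M + 2 * M), fun x => by
        rw [norm_smul, norm_div, Real.norm_of_nonneg hh.le]
        have : ‖u2 x j‖ ≤ M := (coord_le _ _).trans (g2.bd x)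
        gcongr; exacts [bdif _ _]⟩
    exact wt_mul_int (by fun_prop) hK
  have iD : ∀ j, Integrable (D j) := by
    intro j
    obtain ⟨K, hK⟩ := bin (fun x => (δ x j / h) • (u1 (x + s j) - u1 x))
      ⟨(2 * M / h) * (M * ‖s j‖), fun x => by
        rw [norm_smul, norm_div, Real.norm_of_nonneg hh.le]
        have : ‖δ x j‖ ≤ 2 * M := (coord_le _ _).trans (bδ x)
        gcongr; exacts [g1.lip _ _]⟩
    exact wt_mul_int (by fun_prop) hK
  have iB' : ∀ j, Integrable (fun x => B j (x + s j)) := fun j => (iB j).comp_add_right (s j)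
  have eB : ∀ j, ∫ x, B j (x + s j) = ∫ x, B j x := fun j => integral_add_right_eq_self (B j) (s j)
  have iE : Integrable (fun x => wt x * ‖δ x‖ ^ 2) := by
    refine wt_mul_int (K := (2 * M)^2) (by fun_prop) fun x => ?_
    rw [abs_of_nonneg (by positivity)]
    have := bδ x
    gcongr
  have e1 : ∀ x, wt x * inner ℝ (δ x) (gop ν h u1 x - gop ν h u2 x) =
      ∑ j, (A j x + B j x - C j x - D j x) := by
    intro x
    unfold gop
    rw [← Finset.sum_sub_distrib, inner_sum, Finset.mul_sum]
    refine Finset.sum_congr rfl fun j _ => ?_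
    simp only [A, B, C, D]
    rw [← mul_add, ← mul_sub, ← mul_sub, ← inner_add_right, ← inner_sub_right, ← inner_sub_right]
    congr 2
    simp only [hδ, PiLp.sub_apply, hs]
    module
  have e2 : ∫ x, wt x * inner ℝ (δ x) (gop ν h u1 x - gop ν h u2 x) =
      ∑ j, ∫ x, (A j x + B j (x + s j) - C j x - D j x) := by
    simp_rw [e1]
    rw [integral_finsetSum]
    · refine Finset.sum_congr rfl fun j _ => ?_
      rw [int4 (iA j) (iB j) (iC j) (iD j), int4 (iA j) (iB' j) (iC j) (iD j), eB]
    · exact fun j _ => (((iA j).add (iB j)).sub (iC j)).sub (iD j)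
  rw [e2]
  have e3 : ∀ j ∈ (Finset.univ : Finset (Fin d)), ∫ x, (A j x + B j (x + s j) - C j x - D j x) ≤
      ((2 * ν + M) ^ 2 / (4 * ν) + M) * (∫ x, wt x * ‖δ x‖ ^ 2)
      + ((8 * ν * M ^ 2) * ∫ x : Ed d, wt x) * h := by
    intro j _
    have e4 : ((2 * ν + M) ^ 2 / (4 * ν) + M) * (∫ x, wt x * ‖δ x‖ ^ 2)
      + ((8 * ν * M ^ 2) * ∫ x : Ed d, wt x) * h =
      ∫ x, (((2 * ν + M) ^ 2 / (4 * ν) + M) * (wt x * ‖δ x‖ ^ 2) + (8 * ν * M ^ 2 * h) * wt x) := by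
      rw [integral_add (iE.const_mul _) (wt_int.const_mul _), integral_const_mul, integral_const_mul]
      ring
    rw [e4]
    refine integral_mono ((((iA j).add (iB' j)).sub (iC j)).sub (iD j))
      ((iE.const_mul _).add (wt_int.const_mul _)) fun x => ?_
    have := ptw (w := wt x) (wp := wt (x + s j)) (c := u2 x j) (b := δ x j) hν hM hh (wt_pos x)
      (by have := wt_shift x (s j) (by rw [ns]; exact hh1); rwa [ns] at this)
      (δ x) (δ (x + s j)) (u1 (x + s j) - u1 x) ((coord_le _ _).trans (g2.bd x)) (coord_le _ _)
      (by
        have h1 := g1.lip x (s j)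
        have h2 := g2.lip x (s j)
        rw [ns] at h1 h2
        have : δ (x + s j) - δ x = (u1 (x + s j) - u1 x) - (u2 (x + s j) - u2 x) := by
          simp only [hδ]; abel
        rw [this]
        refine (norm_sub_le _ _).trans ?_
        linarith)
      (by have h1 := g1.lip x (s j); rwa [ns] at h1)
    simp only [A, B, C, D, add_sub_cancel_right]
    refine this.trans (le_of_eq ?_)
    ring
  refine (Finset.sum_le_sum e3).trans (le_of_eq ?_)
  simp
  ring

lemma gronwall_zero {E : ℝ → ℝ} (hc : Continuous E) (h0 : ∀ s, 0 ≤ E s) {C τ : ℝ} (hτ : 0 < τ)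
    (hE : ∀ᵐ s, s ∈ Icc (0:ℝ) τ → E s ≤ C * ∫ r in (0:ℝ)..s, E r) :
    ∀ s ∈ Icc (0:ℝ) τ, E s = 0 := by
  set F : ℝ → ℝ := fun s => ∫ r in (0:ℝ)..s, E r with hF
  have dF : ∀ s, HasDerivAt F (E s) s := fun s => intervalIntegral.integral_hasDerivAt_right
    (hc.intervalIntegrable _ _) (hc.stronglyMeasurableAtFilter _ _) hc.continuousAt
  have cF : Continuous F := continuous_iff_continuousAt.2 fun s => (dF s).continuousAt
  have h1 : ∀ s ∈ Ioo (0:ℝ) τ, E s ≤ C * F s := by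
    by_contra hcon
    push Not at hcon
    obtain ⟨s, hs, hs'⟩ := hcon
    have ho : IsOpen (Ioo (0:ℝ) τ ∩ {s | C * F s < E s}) :=
      isOpen_Ioo.inter (isOpen_lt (by fun_prop) hc)
    have hz : volume (Ioo (0:ℝ) τ ∩ {s | C * F s < E s}) = 0 := by
      refine measure_mono_null ?_ (ae_iff.1 hE)
      rintro r ⟨hr, hr'⟩ hcon
      exact absurd (hcon (Ioo_subset_Icc_self hr)) (not_le.2 hr')
    have := (ho.measure_eq_zero_iff (μ := volume)).1 hz
    exact this.subset ⟨hs, hs'⟩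
  have h2 : ∀ s ∈ Icc (0:ℝ) τ, E s ≤ C * F s := by
    intro s hs
    rw [← closure_Ioo hτ.ne] at hs
    exact le_on_closure h1 hc.continuousOn (by fun_prop) hs
  have Fnn : ∀ s ∈ Icc (0:ℝ) τ, 0 ≤ F s := fun s hs =>
    intervalIntegral.integral_nonneg hs.1 fun r _ => h0 r
  have h3 := norm_le_gronwallBound_of_norm_deriv_right_le (f := F) (f' := E) (δ := 0) (K := C) (ε := 0)
    (a := 0) (b := τ) cF.continuousOn (fun s _ => (dF s).hasDerivWithinAt) (by simp [hF])
    (fun s hs => by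
      rw [Real.norm_of_nonneg (h0 s), Real.norm_of_nonneg (Fnn s (Ico_subset_Icc_self hs)), add_zero]
      exact h2 s (Ico_subset_Icc_self hs))
  intro s hs
  have h4 := h3 s hs
  rw [gronwallBound_ε0, zero_mul] at h4
  have h5 : F s = 0 := norm_le_zero_iff.1 h4
  have h6 := h2 s hs
  rw [h5, mul_zero] at h6
  exact le_antisymm h6 (h0 s)

lemma energy_sq {E : Type*} [NormedAddCommGroup E] [InnerProductSpace ℝ E] [CompleteSpace E]
    {f : ℝ → E} (hf : Continuous f) (s : ℝ) :
    ‖∫ r in (0:ℝ)..s, f r‖ ^ 2 = ∫ r in (0:ℝ)..s, 2 * inner ℝ (∫ q in (0:ℝ)..r, f q) (f r) := by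
  have dF : ∀ s, HasDerivAt (fun s => ∫ r in (0:ℝ)..s, f r) (f s) s := fun s =>
    intervalIntegral.integral_hasDerivAt_right
    (hf.intervalIntegrable _ _) (hf.stronglyMeasurableAtFilter _ _) hf.continuousAt
  have cF : Continuous (fun s => ∫ r in (0:ℝ)..s, f r) :=
    continuous_iff_continuousAt.2 fun s => (dF s).continuousAt
  rw [intervalIntegral.integral_eq_sub_of_hasDerivAt (fun r _ => (dF r).norm_sq)
    (Continuous.intervalIntegrable (by fun_prop) _ _)]
  simp

lemma prod_int {d : ℕ} {s K : ℝ} {F : ℝ × Ed d → ℝ} (hF : Continuous F)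
    (hK : ∀ r ∈ Ioc 0 s, ∀ x, |F (r, x)| ≤ K) :
    Integrable (fun p : ℝ × Ed d => wt p.2 * F p)
      ((volume.restrict (Ioc 0 s)).prod (volume : Measure (Ed d))) := by
  have h1 : Integrable (fun p : ℝ × Ed d => wt p.2)
      ((volume.restrict (Ioc 0 s)).prod (volume : Measure (Ed d))) := wt_int.comp_snd _
  have hm : Continuous (fun p : ℝ × Ed d => wt p.2 * F p) := (wt_cont.comp continuous_snd).mul hF
  refine (h1.mul_const K).mono' hm.aestronglyMeasurable ?_
  have : (volume.restrict (Ioc 0 s)).prod (volume : Measure (Ed d)) =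
    (volume.prod volume).restrict (Ioc 0 s ×ˢ univ) := by
    rw [← Measure.prod_restrict, Measure.restrict_univ]
  rw [this]
  refine ae_restrict_of_forall_mem (measurableSet_Ioc.prod MeasurableSet.univ) ?_
  rintro ⟨r, x⟩ ⟨hr, -⟩
  rw [norm_mul, Real.norm_of_nonneg (wt_pos _).le]
  exact mul_le_mul_of_nonneg_left (hK r hr x) (wt_pos _).le

/-- abstract energy inequality step -/
lemma step_ineq {d : ℕ} {s K C0 C1 h : ℝ} (hs : 0 ≤ s) (hK : 0 ≤ K)
    {δ g : ℝ × Ed d → Ed d} (cδ : Continuous δ) (cg : Continuous g)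
    (bδ : ∀ p, ‖δ p‖ ≤ K) (bg : ∀ p, ‖g p‖ ≤ K)
    (cE : Continuous fun r => ∫ x, wt x * ‖δ (r, x)‖ ^ 2)
    (hen : ∀ r, ∫ x, wt x * inner ℝ (δ (r, x)) (g (r, x)) ≤
      C0 * (∫ x, wt x * ‖δ (r, x)‖ ^ 2) + C1 * h) :
    ∫ x, wt x * ‖∫ r in (0:ℝ)..s, g (r, x)‖ ^ 2 ≤
      2 * (C0 * (∫ r in (0:ℝ)..s, ∫ x, wt x * ‖δ (r, x)‖ ^ 2) + C1 * h * s) +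
      2 * K * ∫ p, wt p.2 * ‖δ p - ∫ r in (0:ℝ)..p.1, g (r, p.2)‖
        ∂((volume.restrict (Ioc 0 s)).prod (volume : Measure (Ed d))) := by
  set μ := (volume.restrict (Ioc 0 s)).prod (volume : Measure (Ed d)) with hμ
  set D : ℝ × Ed d → Ed d := fun p => ∫ r in (0:ℝ)..p.1, g (r, p.2) with hD
  have cD : Continuous D :=
    intervalIntegral.continuous_parametric_intervalIntegral_of_continuous
      (f := fun (p : ℝ × Ed d) r => g (r, p.2)) (by fun_prop) continuous_fst
  have bD : ∀ r ∈ Ioc 0 s, ∀ x, ‖D (r, x)‖ ≤ K * s := by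
    intro r hr x
    refine (intervalIntegral.norm_integral_le_of_norm_le_const (C := K) fun q _ => bg _).trans ?_
    simp only [sub_zero]
    rw [abs_of_pos hr.1]
    exact mul_le_mul_of_nonneg_left hr.2 hK
  have i1 : Integrable (fun p => wt p.2 * (inner ℝ (δ p) (g p))) μ := by
    refine prod_int (K := K * K) (by fun_prop) fun r _ x => (abs_real_inner_le_norm _ _).trans ?_
    have := bδ (r, x); have := bg (r, x)
    gcongr
  have i2 : Integrable (fun p => wt p.2 * (inner ℝ (D p) (g p))) μ := by
    refine prod_int (K := (K * s) * K) (by fun_prop) fun r hr x => (abs_real_inner_le_norm _ _).trans ?_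
    have := bD r hr x; have := bg (r, x)
    gcongr
  have i3 : Integrable (fun p => wt p.2 * ‖δ p - D p‖) μ := by
    refine prod_int (K := K + K * s) (by fun_prop) fun r hr x => ?_
    rw [abs_of_nonneg (norm_nonneg _)]
    exact (norm_sub_le _ _).trans (add_le_add (bδ _) (bD r hr x))
  have e1 : ∫ x, wt x * ‖∫ r in (0:ℝ)..s, g (r, x)‖ ^ 2 = 2 * ∫ p, wt p.2 * (inner ℝ (D p) (g p)) ∂μ := by
    rw [hμ, integral_prod_symm _ i2, ← integral_const_mul]
    refine integral_congr_ae (Eventually.of_forall fun x => ?_)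
    simp only
    rw [energy_sq (by fun_prop), intervalIntegral.integral_of_le hs, ← integral_const_mul,
      ← integral_const_mul]
    refine integral_congr_ae (Eventually.of_forall fun r => ?_)
    simp only [hD]
    ring
  have e2 : ∫ p, wt p.2 * (inner ℝ (δ p) (g p)) ∂μ ≤
      C0 * (∫ r in (0:ℝ)..s, ∫ x, wt x * ‖δ (r, x)‖ ^ 2) + C1 * h * s := by
    have e3 : C0 * (∫ r in (0:ℝ)..s, ∫ x, wt x * ‖δ (r, x)‖ ^ 2) + C1 * h * s =
        ∫ r in (0:ℝ)..s, (C0 * (∫ x, wt x * ‖δ (r, x)‖ ^ 2) + C1 * h) := by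
      rw [intervalIntegral.integral_add (Continuous.intervalIntegrable (by fun_prop) _ _)
        (by simp), intervalIntegral.integral_const_mul]
      simp; ring
    rw [e3, hμ, integral_prod _ i1, intervalIntegral.integral_of_le hs]
    refine integral_mono i1.integral_prod_left ?_ fun r => hen r
    have : Continuous fun r => C0 * (∫ x, wt x * ‖δ (r, x)‖ ^ 2) + C1 * h := by fun_prop
    exact (this.intervalIntegrable 0 s).1
  have e4 : ∫ p, wt p.2 * (inner ℝ (D p) (g p)) ∂μ ≤ ∫ p, wt p.2 * (inner ℝ (δ p) (g p)) ∂μ +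
      K * ∫ p, wt p.2 * ‖δ p - D p‖ ∂μ := by
    rw [← integral_const_mul, ← integral_add i1 (i3.const_mul _)]
    refine integral_mono i2 (i1.add (i3.const_mul _)) fun p => ?_
    have : inner ℝ (D p) (g p) ≤ inner ℝ (δ p) (g p) + K * ‖δ p - D p‖ := by
      have h1 : inner ℝ (D p) (g p) = inner ℝ (δ p) (g p) - inner ℝ (δ p - D p) (g p) := by
        rw [inner_sub_left]; ring
      have h2 := (neg_le_abs _).trans (abs_real_inner_le_norm (δ p - D p) (g p))
      have h3 : ‖δ p - D p‖ * ‖g p‖ ≤ ‖δ p - D p‖ * K := by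
        have := bg p
        gcongr
      linarith
    have := mul_le_mul_of_nonneg_left this (wt_pos p.2).le
    simp only
    linarith
  rw [e1]
  linarith

lemma E_cont {d : ℕ} {K : ℝ} {δ : ℝ × Ed d → Ed d} (cδ : Continuous δ) (bδ : ∀ p, ‖δ p‖ ≤ K) :
    Continuous fun r => ∫ x, wt x * ‖δ (r, x)‖ ^ 2 := by
  have cw := wt_cont (d := d)
  refine continuous_of_dominated (bound := fun x => wt x * K ^ 2) (fun r => ?_) (fun r => ?_)
    (wt_int.mul_const _) ?_
  · exact Continuous.aestronglyMeasurable (by fun_prop)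
  · refine Eventually.of_forall fun x => ?_
    rw [norm_mul, Real.norm_of_nonneg (wt_pos x).le, Real.norm_of_nonneg (by positivity)]
    have := bδ (r, x)
    have := wt_pos x
    gcongr
  · exact Eventually.of_forall fun x => by fun_prop

set_option maxHeartbeats 800000 in
lemma uniq {d : ℕ} {ν τ M : ℝ} (hν : 0 < ν) (hτ : 0 < τ) (hM : 0 ≤ M)
    {z1 z2 : ℝ × Ed d → Ed d} (c1 : Continuous z1) (c2 : Continuous z2)
    (g1 : ∀ s, GoodB M fun x => z1 (s, x)) (g2 : ∀ s, GoodB M fun x => z2 (s, x))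
    (hconv : ∀ᵐ p : ℝ × Ed d, p.1 ∈ Icc 0 τ → Tendsto (fun n : ℕ => ∫ r in (0:ℝ)..p.1,
      (gop ν (1 / ((n:ℝ) + 1)) (fun x => z1 (r, x)) p.2 - gop ν (1 / ((n:ℝ) + 1)) (fun x => z2 (r, x)) p.2))
      atTop (𝓝 (z1 p - z2 p))) :
    ∀ s ∈ Icc 0 τ, ∀ x, z1 (s, x) = z2 (s, x) := by
  set δ : ℝ × Ed d → Ed d := fun p => z1 p - z2 p with hδ
  set hn : ℕ → ℝ := fun n => 1 / ((n:ℝ) + 1) with hhn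
  have hnpos : ∀ n, 0 < hn n := fun n => by simp only [hhn]; positivity
  have hn1 : ∀ n, hn n ≤ 1 := fun n => by
    simp only [hhn]
    rw [div_le_one (by positivity)]
    have : (0:ℝ) ≤ n := Nat.cast_nonneg n
    linarith
  have hn0 : Tendsto hn atTop (𝓝 0) := tendsto_one_div_add_atTop_nhds_zero_nat
  set g : ℕ → ℝ × Ed d → Ed d := fun n p =>
    gop ν (hn n) (fun x => z1 (p.1, x)) p.2 - gop ν (hn n) (fun x => z2 (p.1, x)) p.2 with hg
  have cδ : Continuous δ := c1.sub c2
  have cg : ∀ n, Continuous (g n) := fun n => by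
    simp only [hg, gop]
    fun_prop
  set K : ℝ := 2 * M + 2 * (d * (ν * M + M * M)) with hKdef
  have hK : 0 ≤ K := by positivity
  have bδ : ∀ p, ‖δ p‖ ≤ K := fun p => by
    have h1 := norm_sub_le (z1 p) (z2 p)
    have h2 := (g1 p.1).bd p.2
    have h3 := (g2 p.1).bd p.2
    have : 0 ≤ 2 * (d * (ν * M + M * M)) := by positivity
    simp only [hδ, hKdef]
    simp only [Prod.mk.eta] at h2 h3
    linarith
  have bg : ∀ n p, ‖g n p‖ ≤ K := fun n p => by
    refine (norm_sub_le _ _).trans ?_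
    have h2 := gop_bd hν (hnpos n) hM (g1 p.1) p.2
    have h3 := gop_bd hν (hnpos n) hM (g2 p.1) p.2
    simp only [hKdef]
    linarith
  have cE := E_cont cδ bδ
  set E : ℝ → ℝ := fun r => ∫ x, wt x * ‖δ (r, x)‖ ^ 2 with hE
  set C0 : ℝ := d * ((2 * ν + M) ^ 2 / (4 * ν) + M) with hC0
  set C1 : ℝ := d * (8 * ν * M ^ 2) * ∫ x : Ed d, wt x with hC1
  have hen : ∀ n r, ∫ x, wt x * inner ℝ (δ (r, x)) (g n (r, x)) ≤ C0 * E r + C1 * hn n :=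
    fun n r => energy_fixed hν hM (hnpos n) (hn1 n) (by fun_prop) (by fun_prop) (g1 r) (g2 r)
  set D : ℕ → ℝ × Ed d → Ed d := fun n p => ∫ r in (0:ℝ)..p.1, g n (r, p.2) with hD
  have cD : ∀ n, Continuous (D n) := fun n =>
    intervalIntegral.continuous_parametric_intervalIntegral_of_continuous
      (f := fun (p : ℝ × Ed d) r => g n (r, p.2)) (by have := cg n; fun_prop) continuous_fst
  have bD : ∀ n, ∀ r ∈ Icc 0 τ, ∀ x, ‖D n (r, x)‖ ≤ K * τ := by
    intro n r hr x
    refine (intervalIntegral.norm_integral_le_of_norm_le_const (C := K) fun q _ => bg n _).trans ?_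
    simp only [sub_zero]
    rw [abs_of_nonneg hr.1]
    exact mul_le_mul_of_nonneg_left hr.2 hK
  have hconv' : ∀ᵐ p : ℝ × Ed d, p.1 ∈ Icc 0 τ → Tendsto (fun n => D n p) atTop (𝓝 (δ p)) := hconv
  have cw := wt_cont (d := d)
  have E0 : ∀ s, 0 ≤ E s := fun s => integral_nonneg fun x => mul_nonneg (wt_pos x).le (by positivity)
  have main : ∀ᵐ s, s ∈ Icc 0 τ → E s ≤ (2 * C0) * ∫ r in (0:ℝ)..s, E r := by
    have h1 := Measure.ae_ae_of_ae_prod (μ := (volume : Measure ℝ)) (ν := (volume : Measure (Ed d))) hconv'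
    filter_upwards [h1] with s hs hsI
    have L1 : Tendsto (fun n => ∫ x, wt x * ‖D n (s, x)‖ ^ 2) atTop (𝓝 (E s)) := by
      refine tendsto_integral_of_dominated_convergence (fun x => wt x * (K * τ) ^ 2) (fun n => ?_)
        (wt_int.mul_const _) (fun n => ?_) ?_
      · have := cD n
        exact Continuous.aestronglyMeasurable (by fun_prop)
      · refine Eventually.of_forall fun x => ?_
        rw [norm_mul, Real.norm_of_nonneg (wt_pos x).le, Real.norm_of_nonneg (by positivity)]
        have := bD n s hsI x
        have := wt_pos x
        gcongr
      · filter_upwards [hs] with x hx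
        exact (((hx hsI).norm).pow 2).const_mul _
    have L2 : Tendsto (fun n => ∫ p, wt p.2 * ‖δ p - D n p‖
        ∂((volume.restrict (Ioc 0 s)).prod (volume : Measure (Ed d)))) atTop (𝓝 0) := by
      have hμ : (volume.restrict (Ioc 0 s)).prod (volume : Measure (Ed d)) =
        (volume : Measure (ℝ × Ed d)).restrict (Ioc 0 s ×ˢ univ) := by
        rw [Measure.volume_eq_prod, ← Measure.prod_restrict, Measure.restrict_univ]
      have hms : MeasurableSet (Ioc 0 s ×ˢ (univ : Set (Ed d))) := measurableSet_Ioc.prod MeasurableSet.univ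
      have iw : Integrable (fun p : ℝ × Ed d => wt p.2 * (K + K * τ))
          ((volume.restrict (Ioc 0 s)).prod (volume : Measure (Ed d))) := by
        have h1 : Integrable (fun p : ℝ × Ed d => wt p.2)
          ((volume.restrict (Ioc 0 s)).prod (volume : Measure (Ed d))) := wt_int.comp_snd _
        exact h1.mul_const _
      suffices hsuff : Tendsto (fun n => ∫ p, wt p.2 * ‖δ p - D n p‖
        ∂((volume.restrict (Ioc 0 s)).prod (volume : Measure (Ed d)))) atTop
          (𝓝 (∫ p : ℝ × Ed d, (0:ℝ) ∂((volume.restrict (Ioc 0 s)).prod (volume : Measure (Ed d))))) by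
        simpa only [integral_zero] using hsuff
      refine tendsto_integral_of_dominated_convergence (fun p => wt p.2 * (K + K * τ)) (fun n => ?_)
        iw (fun n => ?_) ?_
      · have := cD n
        exact Continuous.aestronglyMeasurable (by fun_prop)
      · rw [hμ]
        refine ae_restrict_of_forall_mem hms ?_
        rintro ⟨r, x⟩ ⟨hr, -⟩
        rw [norm_mul, Real.norm_of_nonneg (wt_pos _).le, norm_norm]
        refine mul_le_mul_of_nonneg_left ?_ (wt_pos _).le
        exact (norm_sub_le _ _).trans (add_le_add (bδ _) (bD n r ⟨hr.1.le, hr.2.trans hsI.2⟩ x))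
      · rw [hμ, ae_restrict_iff' hms]
        filter_upwards [hconv'] with p hp hpm
        have := hp ⟨hpm.1.1.le, hpm.1.2.trans hsI.2⟩
        have := ((tendsto_const_nhds (x := δ p)).sub this).norm.const_mul (wt p.2)
        simpa using this
    have L3 : Tendsto (fun n => 2 * (C0 * (∫ r in (0:ℝ)..s, E r) + C1 * hn n * s) +
        2 * K * ∫ p, wt p.2 * ‖δ p - D n p‖
        ∂((volume.restrict (Ioc 0 s)).prod (volume : Measure (Ed d)))) atTop
        (𝓝 (2 * (C0 * (∫ r in (0:ℝ)..s, E r) + C1 * 0 * s) + 2 * K * 0)) := by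
      exact (((hn0.const_mul C1).mul_const s).const_add _ |>.const_mul 2).add (L2.const_mul _)
    have := le_of_tendsto_of_tendsto' L1 L3 fun n =>
      step_ineq hsI.1 hK cδ (cg n) bδ (bg n) cE (hen n)
    linarith
  intro s hs
  have hz := gronwall_zero cE E0 hτ main s hs
  have hnn : 0 ≤ fun x => wt x * ‖δ (s, x)‖ ^ 2 := fun x => mul_nonneg (wt_pos x).le (by positivity)
  have hi : Integrable fun x => wt x * ‖δ (s, x)‖ ^ 2 := by
    refine wt_mul_int (K := K ^ 2) (by fun_prop) fun x => ?_
    rw [abs_of_nonneg (by positivity)]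
    have := bδ (s, x)
    gcongr
  have hae := (integral_eq_zero_iff_of_nonneg hnn hi).1 hz
  have heq := (Continuous.ae_eq_iff_eq (μ := (volume : Measure (Ed d))) (by fun_prop) continuous_const).1 hae
  intro x
  have hx : wt x * ‖δ (s, x)‖ ^ 2 = 0 := congrFun heq x
  have h2 : ‖δ (s, x)‖ ^ 2 = 0 := (mul_eq_zero.1 hx).resolve_left (wt_pos x).ne'
  have : ‖δ (s, x)‖ = 0 := by simpa using h2
  exact sub_eq_zero.1 (norm_eq_zero.1 this)

lemma goodB_of {d : ℕ} {M : ℝ} {f : Ed d → Ed d} (hf : ContDiff ℝ 2 f)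
    (b0 : ∀ x, ‖f x‖ ≤ M) (b1 : ∀ x, ‖fderiv ℝ f x‖ ≤ M)
    (b2 : ∀ x, ‖fderiv ℝ (fderiv ℝ f) x‖ ≤ M) : GoodB M f := by
  have df : Differentiable ℝ f := hf.differentiable (by norm_num)
  have df' : Differentiable ℝ (fderiv ℝ f) :=
    (hf.fderiv_right (m := 1) (by norm_num)).differentiable (by norm_num)
  refine ⟨b0, fun x v => ?_, fun x v => ?_⟩
  · have := Convex.norm_image_sub_le_of_norm_fderiv_le (𝕜 := ℝ) (f := f) (C := M) (s := univ)
      (fun x _ => df x) (fun x _ => b1 x) convex_univ (mem_univ x) (mem_univ (x + v))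
    simpa using this
  · have dk : Differentiable ℝ (fun y => f (y + v) - f y) := by fun_prop
    have bk : ∀ y, ‖fderiv ℝ (fun y => f (y + v) - f y) y‖ ≤ M * ‖v‖ := by
      intro y
      rw [fderiv_fun_sub (by fun_prop) (by fun_prop), fderiv_comp_add_right]
      have := Convex.norm_image_sub_le_of_norm_fderiv_le (𝕜 := ℝ) (f := fderiv ℝ f) (C := M) (s := univ)
        (fun x _ => df' x) (fun x _ => b2 x) convex_univ (mem_univ y) (mem_univ (y + v))
      simpa using this
    have := Convex.norm_image_sub_le_of_norm_fderiv_le (𝕜 := ℝ) (f := fun y => f (y + v) - f y)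
      (C := M * ‖v‖) (s := univ)
        (fun x _ => dk x) (fun x _ => bk x) convex_univ (mem_univ (x - v)) (mem_univ x)
    have e : f (x + v) + f (x - v) - (2:ℝ) • f x = f (x + v) - f x - (f (x - v + v) - f (x - v)) := by
      rw [sub_add_cancel]; module
    rw [e]
    refine this.trans (le_of_eq ?_)
    rw [sub_sub_cancel]; ring

lemma snd_diff_tendsto {d : ℕ} {f : Ed d → Ed d} (hf : ContDiff ℝ 2 f) (x v : Ed d) :
    Tendsto (fun h : ℝ => (1 / h ^ 2) • (f (x + h • v) + f (x - h • v) - (2:ℝ) • f x)) (𝓝[>] 0)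
      (𝓝 (fderiv ℝ (fun z => fderiv ℝ f z v) x v)) := by
  have df : Differentiable ℝ f := hf.differentiable (by norm_num)
  have cf' : ContDiff ℝ 1 (fderiv ℝ f) := hf.fderiv_right (m := 1) (by norm_num)
  have df' : Differentiable ℝ (fun z => fderiv ℝ f z v) :=
    (cf'.clm_apply contDiff_const).differentiable (by norm_num)
  set L := fderiv ℝ (fun z => fderiv ℝ f z v) x v with hL
  -- derivative of `h ↦ f'(x + h v) v` at zero
  have hd : HasDerivAt (fun h : ℝ => fderiv ℝ f (x + h • v) v) L 0 := by
    have h1 : HasFDerivAt (fun z => fderiv ℝ f z v) (fderiv ℝ (fun z => fderiv ℝ f z v) x)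
      (x + (0:ℝ) • v) := by simpa using (df' x).hasFDerivAt
    have h2 : HasDerivAt (fun h : ℝ => x + h • v) v 0 := by
      simpa using ((hasDerivAt_id (0:ℝ)).smul_const v).const_add x
    exact h1.comp_hasDerivAt 0 h2
  rw [Metric.tendsto_nhds]
  intro ε hε
  have ho := hd.isLittleO
  rw [Asymptotics.isLittleO_iff] at ho
  have ho := ho (show 0 < ε / 4 by positivity)
  rw [Metric.eventually_nhds_iff] at ho
  obtain ⟨r, hr, hro⟩ := ho
  filter_upwards [Ioo_mem_nhdsGT hr] with h hh
  have hh0 : 0 < h := hh.1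
  set q : ℝ → Ed d := fun k => f (x + k • v) + f (x - k • v) - k ^ 2 • L with hq
  have hq' : ∀ k : ℝ, HasDerivAt q (fderiv ℝ f (x + k • v) v - fderiv ℝ f (x - k • v) v - (2 * k) • L) k := by
    intro k
    have a1 : HasDerivAt (fun h : ℝ => x + h • v) v k := by
      simpa using ((hasDerivAt_id k).smul_const v).const_add x
    have a2 : HasDerivAt (fun h : ℝ => x - h • v) (-v) k := by
      simpa using ((hasDerivAt_id k).smul_const v).const_sub x
    have b1 := (df (x + k • v)).hasFDerivAt.comp_hasDerivAt k a1
    have b2 := (df (x - k • v)).hasFDerivAt.comp_hasDerivAt k a2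
    have b3 : HasDerivAt (fun k : ℝ => k ^ 2 • L) ((2 * k) • L) k := by
      simpa using (hasDerivAt_pow 2 k).smul_const L
    have := (b1.add b2).sub b3
    have h' : HasDerivAt q _ k := this
    exact h'.congr_deriv (by simp [sub_eq_add_neg])
  have bd : ∀ k ∈ Icc (0:ℝ) h, ‖fderiv ℝ f (x + k • v) v - fderiv ℝ f (x - k • v) v - (2 * k) • L‖ ≤
      ε / 2 * h := by
    intro k hk
    have k1 := hro (y := k) (by simp [abs_of_nonneg hk.1]; exact hk.2.trans_lt hh.2)
    have k2 := hro (y := -k) (by simp [abs_of_nonneg hk.1]; exact hk.2.trans_lt hh.2)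
    simp only [zero_smul, add_zero, sub_zero, norm_neg, Real.norm_of_nonneg hk.1, neg_smul,
      ← sub_eq_add_neg] at k1 k2
    have e : fderiv ℝ f (x + k • v) v - fderiv ℝ f (x - k • v) v - (2 * k) • L =
      (fderiv ℝ f (x + k • v) v - fderiv ℝ f x v - k • L)
       - (fderiv ℝ f (x - k • v) v - fderiv ℝ f x v - -(k • L)) := by module
    rw [e]
    refine (norm_sub_le _ _).trans ?_
    have : ε / 4 * k ≤ ε / 4 * h := by gcongr; exact hk.2
    linarith
  have mv := Convex.norm_image_sub_le_of_norm_hasDerivWithin_le (f := q) (C := ε / 2 * h) (s := Icc 0 h)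
    (fun k _ => (hq' k).hasDerivWithinAt) bd (convex_Icc _ _) (left_mem_Icc.2 hh0.le) (right_mem_Icc.2 hh0.le)
  have e : (1 / h ^ 2) • (f (x + h • v) + f (x - h • v) - (2:ℝ) • f x) - L = (1 / h^2) • (q h - q 0) := by
    have : L = (1 / h ^ 2) • (h ^ 2 • L) := by
      rw [smul_smul, one_div, inv_mul_cancel₀ (by positivity), one_smul]
    nth_rewrite 1 [this]
    simp only [hq]
    simp
    module
  rw [dist_eq_norm, e, norm_smul, Real.norm_of_nonneg (by positivity)]
  rw [sub_zero, Real.norm_of_nonneg hh0.le] at mv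
  calc 1 / h ^ 2 * ‖q h - q 0‖ ≤ 1 / h ^ 2 * (ε / 2 * h * h) := by gcongr
    _ = ε / 2 := by field_simp
    _ < ε := by linarith

lemma fst_diff_tendsto {d : ℕ} {f : Ed d → Ed d} (hf : ContDiff ℝ 2 f) (x v : Ed d) :
    Tendsto (fun h : ℝ => (1 / h) • (f (x + h • v) - f x)) (𝓝[>] 0) (𝓝 (fderiv ℝ f x v)) := by
  have df : Differentiable ℝ f := hf.differentiable (by norm_num)
  have h2 : HasDerivAt (fun h : ℝ => x + h • v) v 0 := by
    simpa using ((hasDerivAt_id (0:ℝ)).smul_const v).const_add x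
  have h1 : HasFDerivAt f (fderiv ℝ f x) (x + (0:ℝ) • v) := by simpa using (df x).hasFDerivAt
  have h3 := (h1.comp_hasDerivAt 0 h2).tendsto_slope_zero_right
  simpa using h3

lemma gop_tendsto {d : ℕ} {ν : ℝ} {f : Ed d → Ed d} (hf : ContDiff ℝ 2 f) (x : Ed d) :
    Tendsto (fun n : ℕ => gop ν (1 / ((n:ℝ) + 1)) f x) atTop
      (𝓝 (ν • lapl f x - fderiv ℝ f x (f x))) := by
  have hn0 : Tendsto (fun n : ℕ => 1 / ((n:ℝ) + 1)) atTop (𝓝[>] 0) := by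
    refine tendsto_nhdsWithin_iff.2 ⟨tendsto_one_div_add_atTop_nhds_zero_nat, ?_⟩
    exact Eventually.of_forall fun n => by simp only [mem_Ioi]; positivity
  have key : Tendsto (fun h : ℝ => gop ν h f x) (𝓝[>] 0) (𝓝 (ν • lapl f x - fderiv ℝ f x (f x))) := by
    have e : ν • lapl f x - fderiv ℝ f x (f x) = ∑ j : Fin d,
        (ν • fderiv ℝ (fun z => fderiv ℝ f z (EuclideanSpace.single j (1:ℝ))) x
          (EuclideanSpace.single j (1:ℝ)) - (f x j) • fderiv ℝ f x (EuclideanSpace.single j (1:ℝ))) := by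
      rw [Finset.sum_sub_distrib, ← Finset.smul_sum]
      congr 1
      have : f x = ∑ j, (f x j) • (EuclideanSpace.single j (1:ℝ) : Ed d) := by
        ext i
        simp [Finset.sum_apply, Pi.single_apply]
      conv_lhs => rw [this]
      simp only [map_sum, map_smul]
    rw [e]
    unfold gop
    refine tendsto_finsetSum _ fun j _ => ?_
    have t1 := (snd_diff_tendsto hf x (EuclideanSpace.single j (1:ℝ))).const_smul ν
    have t2 := (fst_diff_tendsto hf x (EuclideanSpace.single j (1:ℝ))).const_smul (f x j)
    refine (t1.sub t2).congr fun h => ?_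
    rw [smul_smul, smul_smul, mul_one_div, mul_one_div]
  exact key.comp hn0

abbrev CX (d : ℕ) := C(ℝ × Ed d, Ed d)

instance instMsCX (d : ℕ) : MeasurableSpace (CX d) := borel _
instance instBsCX (d : ℕ) : BorelSpace (CX d) := ⟨rfl⟩

def errN {d : ℕ} (ν : ℝ) (φ : Ed d → Ed d) (n : ℕ) (q : (CX d × CX d) × (ℝ × Ed d)) : Ed d :=
  q.1.1 q.2 - φ q.2.2 - q.1.2 q.2 -
    ∫ r in (0:ℝ)..q.2.1, gop ν (1 / ((n:ℝ) + 1)) (fun x => q.1.1 (r, x)) q.2.2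

def Rset {d : ℕ} (ν τ : ℝ) (φ : Ed d → Ed d) : Set (CX d × CX d) :=
  {q | (∃ M : ℕ, ∀ s, GoodB (M:ℝ) (fun x => q.1 (s, x))) ∧
    ∀ᵐ p : ℝ × Ed d, p.1 ∈ Icc 0 τ → Tendsto (fun n => errN ν φ n (q, p)) atTop (𝓝 0)}


lemma errN_cont {d : ℕ} (ν : ℝ) {φ : Ed d → Ed d} (hφ : Continuous φ) (n : ℕ) :
    Continuous (errN ν φ n) := by
  unfold errN
  refine Continuous.sub (by fun_prop) ?_
  refine intervalIntegral.continuous_parametric_intervalIntegral_of_continuous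
    (f := fun (q : (CX d × CX d) × (ℝ × Ed d)) r =>
      gop ν (1 / ((n:ℝ) + 1)) (fun x => q.1.1 (r, x)) q.2.2) ?_ (by fun_prop)
  unfold gop Function.uncurry
  fun_prop

lemma Rset_meas {d : ℕ} (ν τ : ℝ) {φ : Ed d → Ed d} (hφ : Continuous φ) :
    MeasurableSet (Rset ν τ φ) := by
  unfold Rset
  rw [ofPred_and]
  refine MeasurableSet.inter ?_ ?_
  · rw [ofPred_exists]
    refine MeasurableSet.iUnion fun M => IsClosed.measurableSet ?_
    have : {q : CX d × CX d | ∀ s, GoodB (M:ℝ) (fun x => q.1 (s, x))} =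
      {q | ∀ s x, ‖q.1 (s, x)‖ ≤ M} ∩ ({q | ∀ s x v, ‖q.1 (s, x + v) - q.1 (s, x)‖ ≤ M * ‖v‖} ∩
       {q | ∀ s x v, ‖q.1 (s, x + v) + q.1 (s, x - v) - (2:ℝ) • q.1 (s, x)‖ ≤ M * ‖v‖ ^ 2}) := by
      ext q
      exact ⟨fun h => ⟨fun s => (h s).bd, fun s => (h s).lip, fun s => (h s).snd⟩,
        fun h s => ⟨h.1 s, h.2.1 s, h.2.2 s⟩⟩
    rw [this]
    simp only [ofPred_forall]
    refine IsClosed.inter ?_ (IsClosed.inter ?_ ?_)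
    · refine isClosed_iInter fun s => isClosed_iInter fun x => isClosed_le (by fun_prop) (by fun_prop)
    · refine isClosed_iInter fun s => isClosed_iInter fun x => isClosed_iInter fun v =>
        isClosed_le (by fun_prop) (by fun_prop)
    · refine isClosed_iInter fun s => isClosed_iInter fun x => isClosed_iInter fun v =>
        isClosed_le (by fun_prop) (by fun_prop)
  · have hA : MeasurableSet {q : (CX d × CX d) × (ℝ × Ed d) | ¬ (q.2.1 ∈ Icc 0 τ →
        Tendsto (fun n => errN ν φ n q) atTop (𝓝 0))} := by
      refine MeasurableSet.compl ?_
      have h1 : MeasurableSet {q : (CX d × CX d) × (ℝ × Ed d) | q.2.1 ∈ Icc 0 τ} :=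
        (measurable_snd.fst) measurableSet_Icc
      have h2 : MeasurableSet {q : (CX d × CX d) × (ℝ × Ed d) |
          Tendsto (fun n => errN ν φ n q) atTop (𝓝 0)} :=
        measurableSet_tendsto _ fun n => (errN_cont ν hφ n).measurable
      exact h1.imp h2
    exact (measurable_measure_prodMk_left (ν := (volume : Measure (ℝ × Ed d))) hA)
      (measurableSet_singleton 0)

lemma GoodB.mono {d : ℕ} {M M' : ℝ} (h : M ≤ M') {u : Ed d → Ed d} (hu : GoodB M u) : GoodB M' u :=
  ⟨fun x => (hu.bd x).trans h, fun x v => (hu.lip x v).trans (by gcongr),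
   fun x v => (hu.snd x v).trans (by gcongr)⟩

lemma R_uniq {d : ℕ} {ν τ : ℝ} (hν : 0 < ν) (hτ : 0 < τ) {φ : Ed d → Ed d}
    {z1 z2 e : CX d} (h1 : (z1, e) ∈ Rset ν τ φ) (h2 : (z2, e) ∈ Rset ν τ φ) :
    ∀ s ∈ Icc (0:ℝ) τ, ∀ x, z1 (s, x) = z2 (s, x) := by
  obtain ⟨⟨M1, g1⟩, c1⟩ := h1
  obtain ⟨⟨M2, g2⟩, c2⟩ := h2
  refine uniq (M := max (M1:ℝ) M2) hν hτ (le_max_of_le_left (by positivity)) z1.continuous z2.continuous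
    (fun s => (g1 s).mono (le_max_left _ _)) (fun s => (g2 s).mono (le_max_right _ _)) ?_
  filter_upwards [c1, c2] with p a1 a2 hp
  have h := ((a2 hp).sub (a1 hp)).add_const (z1 p - z2 p)
  rw [sub_zero, zero_add] at h
  refine h.congr fun n => ?_
  have ii : ∀ z : CX d, IntervalIntegrable (fun r => gop ν (1 / ((n:ℝ) + 1)) (fun x => z (r, x)) p.2)
      volume 0 p.1 := by
    intro z
    refine Continuous.intervalIntegrable ?_ _ _
    unfold gop
    fun_prop
  rw [intervalIntegral.integral_sub (ii z1) (ii z2)]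
  unfold errN
  simp only
  abel

lemma polish_prod {X : Type*} [TopologicalSpace X] [PolishSpace X] : PolishSpace (X × X) := by
  let := TopologicalSpace.upgradeIsCompletelyMetrizable X
  infer_instance

lemma adapted_aux {d : ℕ} {ν τ : ℝ} (hν : 0 < ν) (hτ : 0 < τ) {φ : Ed d → Ed d} (hφ : Continuous φ)
    {Ω : Type*} (m : MeasurableSpace Ω) (Z N : Ω → CX d) (hR : ∀ ω, (Z ω, N ω) ∈ Rset ν τ φ)
    (hN : ∀ p, @Measurable Ω (Ed d) m _ (fun ω => N ω p)) (t : ℝ) (ht : t ∈ Icc 0 τ) (x : Ed d) :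
    @Measurable Ω (Ed d) m _ (fun ω => Z ω (t, x)) := by
  obtain ⟨D, hDc, hDd⟩ := TopologicalSpace.exists_countable_dense (ℝ × Ed d)
  have := hDc.to_subtype
  have : PolishSpace (CX d × CX d) := polish_prod
  intro B hB
  let Ψ : CX d × CX d → (D → Ed d) := fun q p => q.2 p
  have hΨ : Continuous Ψ := by
    refine continuous_pi fun p => ?_
    simp only [Ψ]; fun_prop
  have hinj : ∀ q q', Ψ q = Ψ q' → q.2 = q'.2 := by
    intro q q' h
    refine DFunLike.coe_injective (Continuous.ext_on hDd q.2.continuous q'.2.continuous ?_)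
    intro p hp
    exact congrFun h ⟨p, hp⟩
  have hev : Measurable (fun q : CX d × CX d => q.1 (t, x)) :=
    Continuous.measurable (by fun_prop)
  have hS := Rset_meas ν τ hφ
  have a1 : AnalyticSet (Ψ '' (Rset ν τ φ ∩ {q | q.1 (t, x) ∈ B})) :=
    (hS.inter (hev hB)).analyticSet.image_of_continuous hΨ
  have a2 : AnalyticSet (Ψ '' (Rset ν τ φ ∩ {q | q.1 (t, x) ∈ Bᶜ})) :=
    (hS.inter (hev hB.compl)).analyticSet.image_of_continuous hΨ
  have hdis : Disjoint (Ψ '' (Rset ν τ φ ∩ {q | q.1 (t, x) ∈ B}))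
      (Ψ '' (Rset ν τ φ ∩ {q | q.1 (t, x) ∈ Bᶜ})) := by
    rw [Set.disjoint_left]
    rintro _ ⟨⟨z1, e1⟩, ⟨h1, b1⟩, rfl⟩ ⟨⟨z2, e2⟩, ⟨h2, b2⟩, h⟩
    have he : e2 = e1 := hinj _ _ h
    subst he
    have := R_uniq hν hτ h1 h2 t ht x
    simp only [mem_ofPred_eq, mem_compl_iff] at b1 b2
    exact b2 (this ▸ b1)
  obtain ⟨U, hU1, hU2, hU⟩ := a1.measurablySeparable a2 hdis
  have hF : @Measurable Ω (D → Ed d) m _ (fun ω => Ψ (Z ω, N ω)) :=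
    measurable_pi_iff.2 fun p => hN p
  have : (fun ω => Z ω (t, x)) ⁻¹' B = (fun ω => Ψ (Z ω, N ω)) ⁻¹' U := by
    ext ω
    constructor
    · intro h
      exact hU1 ⟨_, ⟨hR ω, h⟩, rfl⟩
    · intro h
      by_contra hc
      exact Set.disjoint_left.1 hU2 ⟨_, ⟨hR ω, hc⟩, rfl⟩ h
  rw [this]
  exact hF hU

lemma clamp_mem {t : ℝ} (ht : 0 ≤ t) (s : ℝ) : max 0 (min s t) ∈ Icc 0 t :=
  ⟨le_max_left _ _, max_le ht (min_le_right _ _)⟩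

def clampC {d : ℕ} {T t : ℝ} (ht : t ∈ Icc 0 T) (w : ℝ → Ed d → Ed d)
    (hw : ContinuousOn (fun p : ℝ × Ed d => w p.1 p.2) (Icc (0:ℝ) T ×ˢ (univ : Set (Ed d)))) : CX d :=
  ⟨fun p => w (max 0 (min p.1 t)) p.2, by
    have : Continuous (fun p : ℝ × Ed d => ((max 0 (min p.1 t), p.2) : ℝ × Ed d)) := by fun_prop
    exact hw.comp_continuous this fun p => ⟨⟨(clamp_mem ht.1 p.1).1, (clamp_mem ht.1 p.1).2.trans ht.2⟩,
      mem_univ _⟩⟩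

lemma sol_good {d : ℕ} {ν T : ℝ} {φ : Ed d → Ed d} {e z : ℝ → Ed d → Ed d}
    (he : IsC02b T e) (hz : SolvesBurgers ν T φ e z) :
    (∀ s ∈ Ioc (0:ℝ) T, ContDiff ℝ 2 (z s)) ∧
    ∃ M : ℕ, ∀ s ∈ Ioc (0:ℝ) T, GoodB (M:ℝ) (z s) := by
  obtain ⟨M1, h1⟩ := he.bdd
  obtain ⟨M2, h2⟩ := hz.1.bdd
  obtain ⟨M3, h3⟩ := hz.1.bddDeriv
  have hzs : ∀ s, z s = (fun x => z s x - e s x) + e s := by intro s; ext1 x; simp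
  have hC : ∀ s ∈ Ioc (0:ℝ) T, ContDiff ℝ 2 (z s) := by
    intro s hs
    rw [hzs s]
    exact (hz.1.contDiffX s hs).add (he.contDiffX s ⟨hs.1.le, hs.2⟩)
  refine ⟨hC, ?_⟩
  obtain ⟨M, hM⟩ := exists_nat_ge (max M2 M3 + M1)
  have m2 := le_max_left M2 M3
  have m3 := le_max_right M2 M3
  refine ⟨M, fun s hs => goodB_of (hC s hs) ?_ ?_ ?_⟩
  all_goals
    have hs' : s ∈ Icc (0:ℝ) T := ⟨hs.1.le, hs.2⟩
    have cw := hz.1.contDiffX s hs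
    have ce := he.contDiffX s hs'
    have dw : Differentiable ℝ (fun x => z s x - e s x) := cw.differentiable (by norm_num)
    have de : Differentiable ℝ (e s) := ce.differentiable (by norm_num)
    intro x
  · have := norm_add_le (z s x - e s x) (e s x)
    rw [sub_add_cancel] at this
    linarith [h2 s hs' x, (h1 s hs' x).1]
  · rw [hzs s, fderiv_add (dw x) (de x)]
    refine (norm_add_le _ _).trans ?_
    linarith [(h3 s hs x).1, (h1 s hs' x).2.1]
  · have dw' : Differentiable ℝ (fderiv ℝ (fun x => z s x - e s x)) :=
      (cw.fderiv_right (m := 1) (by norm_num)).differentiable (by norm_num)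
    have de' : Differentiable ℝ (fderiv ℝ (e s)) :=
      (ce.fderiv_right (m := 1) (by norm_num)).differentiable (by norm_num)
    have e1 : fderiv ℝ (z s) = fderiv ℝ (fun x => z s x - e s x) + fderiv ℝ (e s) := by
      ext1 y
      conv_lhs => rw [hzs s, fderiv_add (dw y) (de y)]
      rfl
    rw [e1, fderiv_add (dw' x) (de' x)]
    have := norm_add_le (fderiv ℝ (fderiv ℝ (fun x => z s x - e s x)) x) (fderiv ℝ (fderiv ℝ (e s)) x)
    linarith [(h3 s hs x).2, (h1 s hs' x).2.2]

lemma sol_cont {d : ℕ} {ν T : ℝ} {φ : Ed d → Ed d} {e z : ℝ → Ed d → Ed d}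
    (he : IsC02b T e) (hz : SolvesBurgers ν T φ e z) :
    ContinuousOn (fun p : ℝ × Ed d => z p.1 p.2) (Icc (0:ℝ) T ×ˢ (univ : Set (Ed d))) := by
  refine (hz.1.cont.add he.cont).congr fun p _ => ?_
  simp

lemma sol_mem {d : ℕ} {ν T t : ℝ} (hν : 0 < ν) {φ : Ed d → Ed d} {e z : ℝ → Ed d → Ed d}
    (he : IsC02b T e) (hz : SolvesBurgers ν T φ e z) (ht : t ∈ Icc 0 T) (ht0 : 0 < t) :
    (clampC ht z (sol_cont he hz), clampC ht e he.cont) ∈ Rset ν t φ := by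
  obtain ⟨hC, M, hM⟩ := sol_good he hz
  set Z := clampC ht z (sol_cont he hz) with hZ
  have hZv : ∀ s x, Z (s, x) = z (max 0 (min s t)) x := fun s x => rfl
  have g1 : ∀ s, 0 < s → GoodB (M:ℝ) (fun x => Z (s, x)) := by
    intro s hs
    simp only [hZv]
    exact hM _ ⟨lt_max_of_lt_right (lt_min hs ht0), (clamp_mem ht0.le s).2.trans ht.2⟩
  have cl : ∀ P : ℝ → Prop, IsClosed {s | P s} → (∀ s, 0 < s → P s) → P 0 := by
    intro P hP h
    have : closure (Ioi (0:ℝ)) ⊆ {s | P s} := closure_minimal (fun s hs => h s hs) hP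
    rw [closure_Ioi] at this
    exact this (mem_Ici.2 le_rfl)
  have g0 : GoodB (M:ℝ) (fun x => Z (0, x)) := by
    refine ⟨fun x => ?_, fun x v => ?_, fun x v => ?_⟩
    · exact cl (fun s => ‖Z (s, x)‖ ≤ M) (isClosed_le (by fun_prop) (by fun_prop))
        fun s hs => (g1 s hs).bd x
    · exact cl (fun s => ‖Z (s, x + v) - Z (s, x)‖ ≤ M * ‖v‖)
        (isClosed_le (by fun_prop) (by fun_prop)) fun s hs => (g1 s hs).lip x v
    · exact cl (fun s => ‖Z (s, x + v) + Z (s, x - v) - (2:ℝ) • Z (s, x)‖ ≤ M * ‖v‖ ^ 2)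
        (isClosed_le (by fun_prop) (by fun_prop)) fun s hs => (g1 s hs).snd x v
  have g : ∀ s, GoodB (M:ℝ) (fun x => Z (s, x)) := by
    intro s
    rcases lt_or_ge 0 s with h | h
    · exact g1 s h
    · have : (fun x => Z (s, x)) = fun x => Z (0, x) := by
        ext1 x
        rw [hZv, hZv, max_eq_left (min_le_of_left_le h), max_eq_left (min_le_left _ _)]
      rw [this]; exact g0
  refine ⟨⟨M, g⟩, Eventually.of_forall fun p hp => ?_⟩
  have hcl : ∀ s ∈ Icc 0 t, max 0 (min s t) = s := by
    intro s hs
    rw [min_eq_left hs.2, max_eq_right hs.1]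
  have lim : Tendsto (fun n : ℕ => ∫ r in (0:ℝ)..p.1, gop ν (1 / ((n:ℝ) + 1)) (fun x => Z (r, x)) p.2)
      atTop (𝓝 (∫ s in (0:ℝ)..p.1, (ν • lapl (z s) p.2 - fderiv ℝ (z s) p.2 (z s p.2)))) := by
    refine intervalIntegral.tendsto_integral_filter_of_dominated_convergence
      (fun _ => d * (ν * M + M * M)) ?_ ?_ ?_ ?_
    · refine Eventually.of_forall fun n => Continuous.aestronglyMeasurable ?_
      unfold gop
      fun_prop
    · exact Eventually.of_forall fun n => Eventually.of_forall fun r _ =>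
        gop_bd hν (by positivity) (by positivity) (g r) p.2
    · exact intervalIntegrable_const
    · refine Eventually.of_forall fun r hr => ?_
      rw [uIoc_of_le hp.1] at hr
      have hr' : r ∈ Icc 0 t := ⟨hr.1.le, hr.2.trans hp.2⟩
      have : (fun x => Z (r, x)) = z r := by
        ext1 x; rw [hZv, hcl r hr']
      rw [this]
      exact gop_tendsto (hC r ⟨hr.1, hr'.2.trans ht.2⟩) p.2
  have eq := hz.2 p.1 ⟨hp.1, hp.2.trans ht.2⟩ p.2
  have h := lim.const_sub (Z p - φ p.2 - clampC ht e he.cont p)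
  have e0 : Z p - φ p.2 - clampC ht e he.cont p -
      ∫ s in (0:ℝ)..p.1, (ν • lapl (z s) p.2 - fderiv ℝ (z s) p.2 (z s p.2)) = 0 := by
    have e1 : Z p = z p.1 p.2 := by
      have := hZv p.1 p.2
      rwa [hcl p.1 hp] at this
    have e2 : clampC ht e he.cont p = e p.1 p.2 := by
      have : clampC ht e he.cont p = e (max 0 (min p.1 t)) p.2 := rfl
      rwa [hcl p.1 hp] at this
    rw [e1, e2, eq]
    abel
  rw [e0] at h
  exact h

lemma hol_cont {d : ℕ} {β : ℝ} (hβ : 0 < β) {φ : Ed d → Ed d} (h : IsCBetaB β φ) : Continuous φ := by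
  obtain ⟨L, hL, hh⟩ := h.holder
  rw [continuous_iff_continuousAt]
  intro x
  rw [ContinuousAt, tendsto_iff_norm_sub_tendsto_zero]
  have : Tendsto (fun y => L * ‖y - x‖ ^ β) (𝓝 x) (𝓝 0) := by
    have hc : Continuous (fun y : Ed d => L * ‖y - x‖ ^ β) :=
      continuous_const.mul (Continuous.rpow_const (by fun_prop) fun _ => Or.inr hβ.le)
    have := hc.tendsto x
    simpa [Real.zero_rpow hβ.ne'] using this
  exact squeeze_zero (fun _ => norm_nonneg _) (fun y => hh y x) this

/-- Theorem 3.2: if the noise `η` is adapted to a filtration `(G_t)`, then the (unique)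
solution `y` of the stochastic Burgers equation is also adapted: for every
`(t,x) ∈ [0,T] × ℝ^d` the map `ω ↦ y(ω,t,x)` is `G_t`-measurable. -/
theorem solution_adapted
    {d : ℕ} (hd : 1 ≤ d) (ν T β : ℝ) (hν : 0 < ν) (hT : 0 < T) (hβ : β ∈ Ioo (0:ℝ) 1)
    {Ω : Type*} [mΩ : MeasurableSpace Ω] (P : Measure Ω) [IsProbabilityMeasure P]
    (G : ℝ → MeasurableSpace Ω) (hGmono : Monotone G) (hGle : ∀ t, G t ≤ mΩ)
    (η : Ω → ℝ → Ed d → Ed d)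
    (hηpath : ∀ ω, IsC02b T (η ω)) (hη0 : ∀ ω x, η ω 0 x = 0)
    (hηadapted : ∀ t ∈ Icc (0:ℝ) T, ∀ x : Ed d,
      @Measurable Ω (Ed d) (G t) _ (fun ω => η ω t x))
    (φ : Ed d → Ed d) (hφ : IsCBetaB β φ)
    (y : Ω → ℝ → Ed d → Ed d)
    -- for each `ω`, `y ω` is the unique solution in the natural class
    (hy : ∀ ω, SolvesBurgers ν T φ (η ω) (y ω))
    (huniq : ∀ ω (z : ℝ → Ed d → Ed d), SolvesBurgers ν T φ (η ω) z →
      ∀ t ∈ Icc (0:ℝ) T, ∀ x, z t x = y ω t x) :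
    ∀ t ∈ Icc (0:ℝ) T, ∀ x : Ed d,
      @Measurable Ω (Ed d) (G t) _ (fun ω => y ω t x) := by
  intro t ht x
  rcases ht.1.eq_or_lt with h0 | h0
  · subst h0
    have : (fun ω => y ω 0 x) = fun _ => φ x := by
      ext1 ω
      rw [(hy ω).2 0 ht x, intervalIntegral.integral_same, hη0, add_zero, add_zero]
    rw [this]
    exact measurable_const
  · have := adapted_aux hν h0 (hol_cont hβ.1 hφ) (G t)
      (fun ω => clampC ht (y ω) (sol_cont (hηpath ω) (hy ω)))
      (fun ω => clampC ht (η ω) (hηpath ω).cont)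
      (fun ω => sol_mem hν (hηpath ω) (hy ω) ht h0)
      (fun p => (hηadapted _ ⟨(clamp_mem h0.le p.1).1, (clamp_mem h0.le p.1).2.trans ht.2⟩ p.2).mono
        (hGmono (clamp_mem h0.le p.1).2) le_rfl)
      t ⟨h0.le, le_rfl⟩ x
    have e : (fun ω => clampC ht (y ω) (sol_cont (hηpath ω) (hy ω)) (t, x)) = fun ω => y ω t x := by
      ext1 ω
      have : clampC ht (y ω) (sol_cont (hηpath ω) (hy ω)) (t, x) = y ω (max 0 (min t t)) x := rfl
      rw [this, min_self, max_eq_right h0.le]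
    rwa [e] at this

end
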